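/- There exists a constant M ≥ 1 such that for all a ∈ [0,1]², all i ∈ Σ and all n ∈ ℕ, the singular values of the Jacobian matrix D_a S_{i|n} satisfy M⁻¹ ≤ α₁(D_a S_{i|n}) / |f_{i|n,x}(a)| ≤ M and M⁻¹ ≤ α₂(D_a S_{i|n}) / |g_{i|n,y}(a)| ≤ M. -/

import Mathlib

open MeasureTheory Filter Set

noncomputable section

namespace FFL

/-- The unit square `[0,1]² ⊆ ℝ²`. -/
def sq : Set (ℝ × ℝ) := Set.Icc (0:ℝ) 1 ×ˢ Set.Icc (0:ℝ) 1

/-- The Euclidean metric on `ℝ²`. -/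
def dE (a b : ℝ × ℝ) : ℝ := Real.sqrt ((a.1 - b.1) ^ 2 + (a.2 - b.2) ^ 2)

/-- Squared Frobenius norm of a 2×2 real matrix. -/
def frobSq (A : Matrix (Fin 2) (Fin 2) ℝ) : ℝ := ∑ i, ∑ j, (A i j) ^ 2

/-- The larger singular value `α₁` of a 2×2 real matrix, i.e. the larger positive square
root of the eigenvalues of `AᵀA`, via the standard closed formula. -/
def sv1 (A : Matrix (Fin 2) (Fin 2) ℝ) : ℝ :=
  Real.sqrt ((frobSq A + Real.sqrt ((frobSq A) ^ 2 - 4 * (A.det) ^ 2)) / 2)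

/-- The smaller singular value `α₂` of a 2×2 real matrix. -/
def sv2 (A : Matrix (Fin 2) (Fin 2) ℝ) : ℝ :=
  Real.sqrt ((frobSq A - Real.sqrt ((frobSq A) ^ 2 - 4 * (A.det) ^ 2)) / 2)

/-- The nonlinear, non-conformal iterated function systems of Falconer, Fraser and Lee:
maps `S i (a₁,a₂) = (f i a₁, g i (a₁,a₂))` on the unit square, where `f i`, `g i` are
`C^{1+α}` contractions (with partial derivatives `fx`, `gx`, `gy`) satisfying the
domination condition. -/
structure System (I : Type) [Fintype I] where
  f : I → ℝ → ℝ
  g : I → ℝ × ℝ → ℝ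
  fx : I → ℝ → ℝ
  gx : I → ℝ × ℝ → ℝ
  gy : I → ℝ × ℝ → ℝ
  /-- the index set has at least two elements -/
  card2 : 2 ≤ Fintype.card I
  /-- each `S i` maps the unit square into itself -/
  mapsTo : ∀ i, Set.MapsTo (fun a => (f i a.1, g i a)) sq sq
  /-- `fx i` is the derivative of `f i` on `[0,1]` -/
  hasDeriv_f : ∀ i, ∀ x ∈ Set.Icc (0:ℝ) 1,
    HasDerivWithinAt (f i) (fx i x) (Set.Icc (0:ℝ) 1) x
  /-- `(gx i, gy i)` is the (total) derivative of `g i` on the unit square -/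
  hasDeriv_g : ∀ i, ∀ a ∈ sq, HasFDerivWithinAt (g i)
      (gx i a • ContinuousLinearMap.fst ℝ ℝ ℝ + gy i a • ContinuousLinearMap.snd ℝ ℝ ℝ) sq a
  /-- the derivatives are `α`-Hölder for some `α > 0`, i.e. `f i`, `g i` are `C^{1+α}` -/
  holder : ∃ α > (0:ℝ), ∃ H > (0:ℝ), ∀ i,
      (∀ x ∈ Set.Icc (0:ℝ) 1, ∀ y ∈ Set.Icc (0:ℝ) 1, |fx i x - fx i y| ≤ H * |x - y| ^ α) ∧
      (∀ a ∈ sq, ∀ b ∈ sq, |gx i a - gx i b| ≤ H * dE a b ^ α) ∧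
      (∀ a ∈ sq, ∀ b ∈ sq, |gy i a - gy i b| ≤ H * dE a b ^ α)
  /-- the maps `f i`, `g i` (hence `S i`) are uniform contractions -/
  contracting : ∃ c, 0 ≤ c ∧ c < 1 ∧ ∀ i,
      (∀ x ∈ Set.Icc (0:ℝ) 1, ∀ y ∈ Set.Icc (0:ℝ) 1, |f i x - f i y| ≤ c * |x - y|) ∧
      (∀ a ∈ sq, ∀ b ∈ sq, |g i a - g i b| ≤ c * dE a b) ∧
      (∀ a ∈ sq, ∀ b ∈ sq, dE (f i a.1, g i a) (f i b.1, g i b) ≤ c * dE a b)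
  /-- the domination condition:
  `inf |f_{i,x}| > sup |g_{i,y}| ≥ inf |g_{i,y}| ≥ d > 0` -/
  domination : ∃ d > (0:ℝ), ∀ i,
      d ≤ sInf ((fun a => |gy i a|) '' sq) ∧
      sSup ((fun a => |gy i a|) '' sq) < sInf ((fun x => |fx i x|) '' Set.Icc (0:ℝ) 1)

variable {I : Type} [Fintype I]

/-- The map `S i`. -/
def S (T : System I) (i : I) (a : ℝ × ℝ) : ℝ × ℝ := (T.f i a.1, T.g i a)

/-- The composition `S_w = S_{i₁} ∘ ⋯ ∘ S_{i_n}` along a finite word `w = (i₁,…,i_n)`. -/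
def Sw (T : System I) : List I → ℝ × ℝ → ℝ × ℝ
  | [], a => a
  | i :: w, a => S T i (Sw T w a)

/-- The top-left entry `f_{w,x}(a)` of the (lower triangular) Jacobian `D_a S_w`,
via the chain rule. -/
def fxw (T : System I) : List I → ℝ × ℝ → ℝ
  | [], _ => 1
  | i :: w, a => T.fx i (Sw T w a).1 * fxw T w a

/-- The bottom-right entry `g_{w,y}(a)` of the Jacobian `D_a S_w`. -/
def gyw (T : System I) : List I → ℝ × ℝ → ℝ
  | [], _ => 1
  | i :: w, a => T.gy i (Sw T w a) * gyw T w a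

/-- The off-diagonal entry `g_{w,x}(a)` of the Jacobian `D_a S_w`. -/
def gxw (T : System I) : List I → ℝ × ℝ → ℝ
  | [], _ => 0
  | i :: w, a => T.gx i (Sw T w a) * fxw T w a + T.gy i (Sw T w a) * gxw T w a

/-- The Jacobian matrix `D_a S_w`. -/
def Dmat (T : System I) (w : List I) (a : ℝ × ℝ) : Matrix (Fin 2) (Fin 2) ℝ :=
  !![fxw T w a, 0; gxw T w a, gyw T w a]

/-- The larger singular value `α₁(D_a S_w)`. -/
def alpha1 (T : System I) (w : List I) (a : ℝ × ℝ) : ℝ := sv1 (Dmat T w a)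

/-- The smaller singular value `α₂(D_a S_w)`. -/
def alpha2 (T : System I) (w : List I) (a : ℝ × ℝ) : ℝ := sv2 (Dmat T w a)

/-- The restriction `i|n` of an infinite sequence to its first `n` symbols. -/
def word (ii : ℕ → I) (n : ℕ) : List I := List.ofFn (fun k : Fin n => ii k.1)

/-- The iterated left shift `σⁿ`. -/
def shiftn (ii : ℕ → I) (n : ℕ) : ℕ → I := fun k => ii (k + n)

/-- The left shift `σ` on `Σ = I^ℕ`. -/
def shift (ii : ℕ → I) : ℕ → I := fun k => ii (k + 1)

/-- The cylinder set `[w] ⊆ Σ` of a finite word `w`. -/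
def cyl (w : List I) : Set (ℕ → I) := {jj | ∀ k : Fin w.length, jj k.1 = w.get k}

/-- `F` is the attractor of the IFS: the (unique) nonempty compact subset of the unit
square with `F = ⋃ i, S i '' F`. -/
def IsAttractor (T : System I) (F : Set (ℝ × ℝ)) : Prop :=
  F.Nonempty ∧ IsCompact F ∧ F ⊆ sq ∧ F = ⋃ i, S T i '' F

/-- The strong separation condition: the sets `S i '' F` are pairwise disjoint. -/
def SSC (T : System I) (F : Set (ℝ × ℝ)) : Prop :=
  ∀ i j : I, i ≠ j → Disjoint (S T i '' F) (S T j '' F)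

/-- `Pi` is the canonical coding map `Π : Σ → [0,1]²`:
`Π(i)` is the unique point of `⋂ₙ S_{i|n}([0,1]²)`. -/
def IsCoding (T : System I) (Pi : (ℕ → I) → ℝ × ℝ) : Prop :=
  ∀ ii : ℕ → I, ∀ n : ℕ, Pi ii ∈ Sw T (word ii n) '' sq

/-- `m` is quasi-Bernoulli with constant `L`:
`L⁻¹ m[w] m[v] ≤ m[wv] ≤ L m[w] m[v]` for all finite words `w, v`. -/
def QuasiBernoulli [MeasurableSpace I] (m : Measure (ℕ → I)) (L : ℝ) : Prop :=
  0 < L ∧ ∀ w v : List I,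
    L⁻¹ * (m (cyl w)).toReal * (m (cyl v)).toReal ≤ (m (cyl (w ++ v))).toReal ∧
    (m (cyl (w ++ v))).toReal ≤ L * (m (cyl w)).toReal * (m (cyl v)).toReal

/-- The interval `Q₁(x,r) = [x - r/2, x + r/2]`. -/
def Q1 (x r : ℝ) : Set ℝ := Set.Icc (x - r / 2) (x + r / 2)

/-- The square `Q₂(a,r) = (a₁ - r/2, a₁ + r/2) × (a₂ - r/2, a₂ + r/2)`. -/
def Q2 (a : ℝ × ℝ) (r : ℝ) : Set (ℝ × ℝ) :=
  Set.Ioo (a.1 - r / 2) (a.1 + r / 2) ×ˢ Set.Ioo (a.2 - r / 2) (a.2 + r / 2)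

/-- The approximate square `B_n(a,r)`: points `b ∈ S_w([0,1]²)` with `|b₁ - a₁| ≤ r/2`. -/
def Bn (T : System I) (w : List I) (a : ℝ × ℝ) (r : ℝ) : Set (ℝ × ℝ) :=
  {b ∈ Sw T w '' sq | |b.1 - a.1| ≤ r / 2}

/-- The closed Euclidean ball in `ℝ²`. -/
def ballE (x : ℝ × ℝ) (r : ℝ) : Set (ℝ × ℝ) := {y | dE x y ≤ r}

/-- A measure on `ℝ` is exact dimensional with dimension `s` if for a.e. `x`,
`log ν(B(x,r)) / log r → s` as `r → 0⁺`. -/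
def ExactDim1 (ν : Measure ℝ) (s : ℝ) : Prop :=
  ∀ᵐ x ∂ν, Tendsto (fun r => Real.log (ν (Metric.closedBall x r)).toReal / Real.log r)
    (nhdsWithin 0 (Set.Ioi 0)) (nhds s)

/-- A measure on `ℝ²` is exact dimensional with dimension `s` (w.r.t. Euclidean balls). -/
def ExactDim2 (ν : Measure (ℝ × ℝ)) (s : ℝ) : Prop :=
  ∀ᵐ x ∂ν, Tendsto (fun r => Real.log (ν (ballE x r)).toReal / Real.log r)
    (nhdsWithin 0 (Set.Ioi 0)) (nhds s)

/-- `η = sup_{i ∈ I, a, b ∈ [0,1]²} |g_{i,y}(a)| / |f_{i,x}(b)|`. -/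
def eta (T : System I) : ℝ :=
  sSup {x : ℝ | ∃ i : I, ∃ a ∈ sq, ∃ b ∈ sq, x = |T.gy i a| / |T.fx i b.1|}

end FFL

open FFL

namespace FFL

lemma dE_le_two {a b : ℝ × ℝ} (ha : a ∈ sq) (hb : b ∈ sq) : dE a b ≤ 2 := by
  obtain ⟨⟨h1, h2⟩, h3, h4⟩ := ha
  obtain ⟨⟨k1, k2⟩, k3, k4⟩ := hb
  refine Real.sqrt_le_iff.mpr ⟨by norm_num, ?_⟩
  have e1 : (a.1 - b.1) ^ 2 ≤ 1 := by
    rw [sq_le_one_iff_abs_le_one, abs_le]; constructor <;> linarith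
  have e2 : (a.2 - b.2) ^ 2 ≤ 1 := by
    rw [sq_le_one_iff_abs_le_one, abs_le]; constructor <;> linarith
  linarith

lemma zero_mem_sq : (0 : ℝ × ℝ) ∈ sq :=
  ⟨Set.left_mem_Icc.mpr zero_le_one, Set.left_mem_Icc.mpr zero_le_one⟩

/-- A Hölder function on the unit square is bounded. -/
lemma abs_le_of_holder {h : ℝ × ℝ → ℝ} {H α : ℝ} (hH : 0 < H) (hα : 0 < α)
    (hh : ∀ a ∈ sq, ∀ b ∈ sq, |h a - h b| ≤ H * dE a b ^ α) {a : ℝ × ℝ} (ha : a ∈ sq) :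
    |h a| ≤ |h 0| + H * 2 ^ α := by
  have h1 : dE a 0 ^ α ≤ 2 ^ α :=
    Real.rpow_le_rpow (Real.sqrt_nonneg _) (dE_le_two ha zero_mem_sq) hα.le
  have h2 := hh a ha 0 zero_mem_sq
  have h3 := abs_sub_abs_le_abs_sub (h a) (h 0)
  have h4 := mul_le_mul_of_nonneg_left h1 hH.le
  linarith

lemma Sw_mem_sq {I : Type} [Fintype I] (T : System I) (w : List I) {a : ℝ × ℝ}
    (ha : a ∈ sq) : Sw T w a ∈ sq := by
  induction w with
  | nil => exact ha
  | cons i w ih => exact T.mapsTo i ih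

/-- Uniform bounds on the partial derivatives: `g_{i,x}` is bounded, `g_{i,y}` does not vanish,
and the gap in the domination condition is bounded below. -/
lemma exists_uniform_domination {I : Type} [Fintype I] (T : System I) :
    ∃ G ≥ (0 : ℝ), ∃ δ > (0 : ℝ), ∀ i, ∀ a ∈ sq,
      |T.gx i a| ≤ G ∧ 0 < |T.gy i a| ∧ |T.gy i a| + δ ≤ |T.fx i a.1| := by
  obtain ⟨α, hα, H, hH, hol⟩ := T.holder
  obtain ⟨d, hd, dom⟩ := T.domination
  have hcard := T.card2
  have : Nonempty I := Fintype.card_pos_iff.mp (by omega)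
  obtain ⟨k, hk⟩ := Finite.exists_min fun i =>
    sInf ((fun x => |T.fx i x|) '' Set.Icc (0:ℝ) 1) - sSup ((fun a => |T.gy i a|) '' sq)
  refine ⟨∑ i, |T.gx i 0| + H * 2 ^ α, by positivity, _, sub_pos.mpr (dom k).2,
    fun i a ha => ⟨?_, ?_, ?_⟩⟩
  · have h1 := abs_le_of_holder hH hα (hol i).2.1 ha
    have h2 := Finset.single_le_sum (f := fun i => |T.gx i 0|) (fun j _ => abs_nonneg _)
      (Finset.mem_univ i)
    linarith
  · refine (hd.trans_le (dom i).1).trans_le (csInf_le ⟨0, ?_⟩ (Set.mem_image_of_mem _ ha))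
    rintro _ ⟨b, -, rfl⟩
    exact abs_nonneg _
  · have h1 : |T.gy i a| ≤ sSup ((fun a => |T.gy i a|) '' sq) := by
      refine le_csSup ⟨|T.gy i 0| + H * 2 ^ α, ?_⟩
        (Set.mem_image_of_mem (fun a => |T.gy i a|) ha)
      rintro _ ⟨b, hb, rfl⟩
      exact abs_le_of_holder hH hα (hol i).2.2 hb
    have h2 : sInf ((fun x => |T.fx i x|) '' Set.Icc (0:ℝ) 1) ≤ |T.fx i a.1| := by
      refine csInf_le ⟨0, ?_⟩ (Set.mem_image_of_mem (fun x => |T.fx i x|) ha.1)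
      rintro _ ⟨b, -, rfl⟩
      exact abs_nonneg _
    have h3 := hk i
    linarith

/-- The diagonal entry `f_{w,x}` dominates the other entries of the Jacobian. -/
lemma exists_jacobian_bounds {I : Type} [Fintype I] (T : System I) :
    ∃ C ≥ (0 : ℝ), ∀ (w : List I), ∀ a ∈ sq,
      0 < |gyw T w a| ∧ |gyw T w a| ≤ |fxw T w a| ∧ |gxw T w a| ≤ C * |fxw T w a| := by
  obtain ⟨G, hG, δ, hδ, hT⟩ := exists_uniform_domination T
  refine ⟨G / δ, by positivity, fun w a ha => ?_⟩
  induction w with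
  | nil => simp only [gyw, fxw, gxw, abs_one, abs_zero]; exact ⟨one_pos, le_rfl, by positivity⟩
  | cons i w ih =>
    obtain ⟨h1, h2, h3⟩ := ih
    obtain ⟨k1, k2, k3⟩ := hT i _ (Sw_mem_sq T w ha)
    simp only [gyw, fxw, gxw, abs_mul]
    refine ⟨mul_pos k2 h1, mul_le_mul (by linarith) h2 h1.le (abs_nonneg _), ?_⟩
    have hC : G / δ * δ = G := div_mul_cancel₀ G hδ.ne'
    calc _ ≤ |T.gx i (Sw T w a)| * |fxw T w a| + |T.gy i (Sw T w a)| * |gxw T w a| := by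
          simpa only [abs_mul] using abs_add_le (T.gx i (Sw T w a) * fxw T w a)
            (T.gy i (Sw T w a) * gxw T w a)
      _ ≤ G * |fxw T w a| + |T.gy i (Sw T w a)| * (G / δ * |fxw T w a|) := by gcongr
      _ = G / δ * ((|T.gy i (Sw T w a)| + δ) * |fxw T w a|) := by
          linear_combination (-|fxw T w a|) * hC
      _ ≤ _ := by gcongr

lemma four_mul_det_sq_le (A : Matrix (Fin 2) (Fin 2) ℝ) :
    4 * A.det ^ 2 ≤ frobSq A ^ 2 := by
  have h1 : 2 * |A.det| ≤ frobSq A := by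
    simp only [frobSq, Fin.sum_univ_two, Matrix.det_fin_two]
    rcases abs_cases (A 0 0 * A 1 1 - A 0 1 * A 1 0) with ⟨h, -⟩ | ⟨h, -⟩ <;> rw [h] <;>
    nlinarith [sq_nonneg (A 0 0 - A 1 1), sq_nonneg (A 0 1 + A 1 0),
      sq_nonneg (A 0 0 + A 1 1), sq_nonneg (A 0 1 - A 1 0)]
  have h2 := pow_le_pow_left₀ (by positivity) h1 2
  rw [mul_pow, sq_abs] at h2
  linarith

lemma frobSq_nonneg (A : Matrix (Fin 2) (Fin 2) ℝ) : 0 ≤ frobSq A := by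
  unfold frobSq; positivity

lemma sv1_mul_sv2 (A : Matrix (Fin 2) (Fin 2) ℝ) : sv1 A * sv2 A = |A.det| := by
  have h := four_mul_det_sq_le A
  have hf := frobSq_nonneg A
  have h0 := Real.sq_sqrt (sub_nonneg.mpr h)
  rw [sv1, sv2, ← Real.sqrt_mul (by positivity), ← Real.sqrt_sq_eq_abs]
  congr 1
  linear_combination (-1 / 4) * h0

lemma sv1_sq_le (A : Matrix (Fin 2) (Fin 2) ℝ) : sv1 A ^ 2 ≤ frobSq A := by
  have hf := frobSq_nonneg A
  have h : √(frobSq A ^ 2 - 4 * A.det ^ 2) ≤ frobSq A :=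
    Real.sqrt_le_iff.mpr ⟨hf, by linarith [sq_nonneg A.det]⟩
  rw [sv1, Real.sq_sqrt (by positivity)]
  linarith

lemma frobSq_le_two_mul_sv1_sq (A : Matrix (Fin 2) (Fin 2) ℝ) :
    frobSq A ≤ 2 * sv1 A ^ 2 := by
  have hf := frobSq_nonneg A
  have h := Real.sqrt_nonneg (frobSq A ^ 2 - 4 * A.det ^ 2)
  rw [sv1, Real.sq_sqrt (by positivity)]
  linarith

end FFL

/-- the singular values of the Jacobians are comparable to the diagonal
entries. -/
theorem stmt2 {I : Type} [Fintype I] (T : System I) :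
    ∃ M : ℝ, 1 ≤ M ∧ ∀ a ∈ sq, ∀ (ii : ℕ → I) (n : ℕ),
      (M⁻¹ ≤ alpha1 T (word ii n) a / |fxw T (word ii n) a| ∧
        alpha1 T (word ii n) a / |fxw T (word ii n) a| ≤ M) ∧
      (M⁻¹ ≤ alpha2 T (word ii n) a / |gyw T (word ii n) a| ∧
        alpha2 T (word ii n) a / |gyw T (word ii n) a| ≤ M) := by
  obtain ⟨C, hC, hb⟩ := exists_jacobian_bounds T
  refine ⟨2 + C, by linarith, fun a ha ii n => ?_⟩
  obtain ⟨h1, h2, h3⟩ := hb (word ii n) a ha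
  have hM : 0 < 2 + C := by linarith
  have hf : 0 < |fxw T (word ii n) a| := h1.trans_le h2
  have hfrob : frobSq (Dmat T (word ii n) a) =
      |fxw T (word ii n) a| ^ 2 + |gxw T (word ii n) a| ^ 2 + |gyw T (word ii n) a| ^ 2 := by
    simp [frobSq, Dmat, Fin.sum_univ_two, add_assoc]
  have hprod : alpha1 T (word ii n) a * alpha2 T (word ii n) a =
      |fxw T (word ii n) a| * |gyw T (word ii n) a| := by
    rw [alpha1, alpha2, sv1_mul_sv2, ← abs_mul]
    simp [Dmat, Matrix.det_fin_two]
  have hup : alpha1 T (word ii n) a ^ 2 ≤ _ := sv1_sq_le (Dmat T (word ii n) a)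
  have hlow : _ ≤ 2 * alpha1 T (word ii n) a ^ 2 :=
    frobSq_le_two_mul_sv1_sq (Dmat T (word ii n) a)
  have hnonneg : 0 ≤ alpha1 T (word ii n) a := Real.sqrt_nonneg _
  rw [hfrob] at hup hlow
  generalize alpha1 T (word ii n) a = s at *
  generalize alpha2 T (word ii n) a = t at *
  generalize |fxw T (word ii n) a| = f at *
  generalize |gyw T (word ii n) a| = g at *
  have hx : 0 ≤ |gxw T (word ii n) a| := abs_nonneg _
  generalize |gxw T (word ii n) a| = x at *
  have hs : s ≤ (2 + C) * f := by
    refine le_of_sq_le_sq ?_ (by positivity)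
    have := pow_le_pow_left₀ hx h3 2
    have := pow_le_pow_left₀ h1.le h2 2
    nlinarith [mul_nonneg hC (sq_nonneg f)]
  have hs' : f ≤ (2 + C) * s := by
    have : f ≤ 2 * s := by
      refine le_of_sq_le_sq ?_ (by positivity)
      nlinarith [sq_nonneg x, sq_nonneg g]
    nlinarith [mul_nonneg hC hnonneg]
  have hs0 : 0 < s := pos_of_mul_pos_right (hf.trans_le hs') hM.le
  obtain rfl : t = f * g / s := by field_simp; linarith
  refine ⟨⟨?_, ?_⟩, ?_, ?_⟩
  · rw [inv_le_iff_one_le_mul₀ hM, div_mul_eq_mul_div, one_le_div hf]; linarith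
  · rwa [div_le_iff₀ hf]
  · rw [div_right_comm, mul_div_cancel_right₀ _ h1.ne', inv_le_iff_one_le_mul₀ hM,
      div_mul_eq_mul_div, one_le_div hs0]
    linarith
  · rw [div_right_comm, mul_div_cancel_right₀ _ h1.ne', div_le_iff₀ hs0]
    exact hs'
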